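/- Let N be a finite ground set with |N| ≤ 4 and let f : 2^N → ℝ be subadditive with f(∅) = 0. Then the ℓ¹-divergence Δ_f is supermodular as a function on subsets of 2^N ∖ 𝒦₀: for every 𝒦 ⊆ 2^N ∖ 𝒦₀ and all distinct S, Z ∈ (2^N ∖ 𝒦₀) ∖ 𝒦 one has Δ_f(𝒦 ∪ {S, Z}) − Δ_f(𝒦 ∪ {S}) ≥ Δ_f(𝒦 ∪ {Z}) − Δ_f(𝒦). -/

import Mathlib

open Finset

/-- The minimal information family: the empty set, the ground set, and all singletons. -/
def K0 (N : Type*) [Fintype N] : Set (Finset N) :=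
  {∅, (Finset.univ : Finset N)} ∪ {S : Finset N | ∃ i : N, S = {i}}

/-- A set function is subadditive if `f (S ∪ T) ≤ f S + f T` for disjoint `S`, `T`. -/
def SubadditiveSF {N : Type*} [DecidableEq N] (f : Finset N → ℝ) : Prop :=
  ∀ S T : Finset N, Disjoint S T → f (S ∪ T) ≤ f S + f T

/-- A set function is monotone if `S ⊆ T` implies `f S ≤ f T`. -/
def MonotoneSF {N : Type*} (f : Finset N → ℝ) : Prop :=
  ∀ S T : Finset N, S ⊆ T → f S ≤ f T

/-- Elementwise monotonicity: `f S ≤ f (S ∪ {i})`. -/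
def MonotoneStep {N : Type*} [DecidableEq N] (f : Finset N → ℝ) : Prop :=
  ∀ (S : Finset N) (i : N), i ∉ S → f S ≤ f (insert i S)

/-- Upper completion: minimum of `∑ f Sᵢ` over families of pairwise disjoint nonempty
sets `Sᵢ ∈ K` partitioning `S`; it is `0` at `∅`. -/
noncomputable def upperC {N : Type*} [DecidableEq N] (f : Finset N → ℝ)
    (K : Set (Finset N)) (S : Finset N) : ℝ :=
  if S = ∅ then 0 else
    sInf {x : ℝ | ∃ P : Finset (Finset N),
      (∀ T ∈ P, T ∈ K) ∧ (∀ T ∈ P, T ≠ ∅) ∧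
      (∀ T₁ ∈ P, ∀ T₂ ∈ P, T₁ ≠ T₂ → Disjoint T₁ T₂) ∧
      P.sup id = S ∧ x = ∑ T ∈ P, f T}

/-- Lower completion: maximum of `f T - upperC f K (T \ S)` over `T ∈ K` with `S ⊆ T`. -/
noncomputable def lowerC {N : Type*} [DecidableEq N] (f : Finset N → ℝ)
    (K : Set (Finset N)) (S : Finset N) : ℝ :=
  sSup {x : ℝ | ∃ T ∈ K, S ⊆ T ∧ x = f T - upperC f K (T \ S)}

/-- The ℓ¹-divergence of `f` with revealed family `K ⊆ 2^N \ K0`. -/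
noncomputable def ldiv {N : Type*} [Fintype N] [DecidableEq N] (f : Finset N → ℝ)
    (K : Set (Finset N)) : ℝ :=
  ∑ T : Finset N, (upperC f (K0 N ∪ K) T - lowerC f (K0 N ∪ K) T)

/-- SAM upper completion: minimum of `∑ f Sᵢ` over nonempty finite families
`S₁, …, S_k ∈ K` covering `S`. -/
noncomputable def samUpper {N : Type*} [DecidableEq N] (f : Finset N → ℝ)
    (K : Set (Finset N)) (S : Finset N) : ℝ :=
  sInf {x : ℝ | ∃ (k : ℕ) (Ss : Fin (k + 1) → Finset N),
    (∀ i, Ss i ∈ K) ∧ S ⊆ Finset.univ.sup Ss ∧ x = ∑ i, f (Ss i)}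

/-- SAM lower completion. -/
noncomputable def samLower {N : Type*} [DecidableEq N] (f : Finset N → ℝ)
    (K : Set (Finset N)) (S : Finset N) : ℝ :=
  max (sSup {x : ℝ | ∃ Y ∈ K, Y ⊆ S ∧ x = f Y})
      (sSup {x : ℝ | ∃ X ∈ K, S ⊆ X ∧ x = f X - samUpper f K (X \ S)})

/-- The SAM ℓ¹-divergence. -/
noncomputable def samDiv {N : Type*} [Fintype N] [DecidableEq N] (f : Finset N → ℝ)
    (K : Set (Finset N)) : ℝ :=
  ∑ T : Finset N, (samUpper f (K0 N ∪ K) T - samLower f (K0 N ∪ K) T)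

/-- `{(α i, T i)}` is a fractional cover of `S`. -/
def IsFracCover {N : Type*} [DecidableEq N] (S : Finset N) (k : ℕ)
    (α : Fin k → ℝ) (T : Fin k → Finset N) : Prop :=
  (∀ i, 0 < α i) ∧
  ∀ j ∈ S, (1 : ℝ) ≤ ∑ i ∈ Finset.univ.filter (fun i => j ∈ T i), α i

/-- A set function is fractionally subadditive. -/
def FracSubadditive {N : Type*} [DecidableEq N] (f : Finset N → ℝ) : Prop :=
  ∀ (S : Finset N) (k : ℕ) (α : Fin k → ℝ) (T : Fin k → Finset N),
    IsFracCover S k α T → f S ≤ ∑ i, α i * f (T i)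

/-- XOS: pointwise maximum of finitely many nonnegative additive set functions. -/
def IsXOS {N : Type*} (f : Finset N → ℝ) : Prop :=
  ∃ (s : ℕ) (a : Fin (s + 1) → N → ℝ),
    (∀ i j, 0 ≤ a i j) ∧
    ∀ S : Finset N, f S = Finset.univ.sup' Finset.univ_nonempty (fun i => ∑ j ∈ S, a i j)

/-- XOS upper completion: infimum of `∑ αᵢ f Tᵢ` over fractional covers of `S`
using sets from `K`. -/
noncomputable def xosUpper {N : Type*} [DecidableEq N] (f : Finset N → ℝ)
    (K : Set (Finset N)) (S : Finset N) : ℝ :=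
  sInf {x : ℝ | ∃ (k : ℕ) (α : Fin k → ℝ) (T : Fin k → Finset N),
    IsFracCover S k α T ∧ (∀ i, T i ∈ K) ∧ x = ∑ i, α i * f (T i)}

/-- `P` is a partition of `S` into nonempty members of `K`. -/
def IsPartitionInto {N : Type*} [DecidableEq N] (K : Set (Finset N)) (S : Finset N)
    (P : Finset (Finset N)) : Prop :=
  (∀ T ∈ P, T ∈ K) ∧ (∀ T ∈ P, T ≠ ∅) ∧
    (∀ T₁ ∈ P, ∀ T₂ ∈ P, T₁ ≠ T₂ → Disjoint T₁ T₂) ∧ P.sup id = S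

theorem two_le_card_of_notMem_K0 {N : Type*} [Fintype N] {S : Finset N} (hS : S ∉ K0 N) :
    2 ≤ S.card := by
  by_contra! h
  apply hS
  rcases Nat.le_one_iff_eq_zero_or_eq_one.mp (Nat.lt_succ_iff.mp h) with h | h
  · exact Or.inl (Or.inl (Finset.card_eq_zero.mp h))
  · exact Or.inr (Finset.card_eq_one.mp h)

theorem card_lt_of_notMem_K0 {N : Type*} [Fintype N] {S : Finset N} (hS : S ∉ K0 N) :
    S.card < Fintype.card N := by
  rw [Finset.card_lt_iff_ne_univ]
  rintro rfl
  exact hS (Or.inl (Or.inr rfl))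

section Completions

variable {N : Type*} [DecidableEq N] {f : Finset N → ℝ} {K L : Set (Finset N)}
  {S T : Finset N} {P : Finset (Finset N)}

theorem IsPartitionInto.subset (h : IsPartitionInto K S P) (hT : T ∈ P) : T ⊆ S := by
  rw [← h.2.2.2]
  exact Finset.le_sup (f := id) hT

theorem IsPartitionInto.of_forall_mem (h : IsPartitionInto K S P) (hL : ∀ T ∈ P, T ∈ L) :
    IsPartitionInto L S P :=
  ⟨hL, h.2⟩

theorem IsPartitionInto.le_sum (hf0 : f ∅ = 0) (hsub : SubadditiveSF f)
    (h : IsPartitionInto K S P) : f S ≤ ∑ T ∈ P, f T := by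
  obtain ⟨-, -, hdisj, rfl⟩ := h
  induction P using Finset.induction_on with
  | empty => simp [hf0]
  | insert A P hA ih =>
    rw [Finset.sum_insert hA, Finset.sup_insert]
    have hAP : Disjoint A (P.sup id) := by
      rw [Finset.disjoint_sup_right]
      intro B hB
      exact hdisj A (by simp) B (by simp [hB]) (by rintro rfl; exact hA hB)
    have hP := ih fun A hA B hB => hdisj A (by simp [hA]) B (by simp [hB])
    have := hsub _ _ hAP
    simp only [id, Finset.sup_eq_union] at this ⊢
    linarith

theorem upperC_eq_sInf (hS : S ≠ ∅) :
    upperC f K S = sInf {x : ℝ | ∃ P, IsPartitionInto K S P ∧ x = ∑ T ∈ P, f T} := by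
  simp only [upperC, if_neg hS, IsPartitionInto, and_assoc]

variable [Fintype N]

theorem isPartitionInto_singletons (hK : K0 N ⊆ K) (S : Finset N) :
    IsPartitionInto K S (S.image fun i => {i}) := by
  refine ⟨?_, ?_, ?_, ?_⟩
  · simp only [Finset.mem_image]
    rintro _ ⟨i, -, rfl⟩
    exact hK (Or.inr ⟨i, rfl⟩)
  · simp only [Finset.mem_image]
    rintro _ ⟨i, -, rfl⟩
    simp
  · simp only [Finset.mem_image]
    rintro _ ⟨i, -, rfl⟩ _ ⟨j, -, rfl⟩ hij
    rw [Finset.disjoint_singleton]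
    rintro rfl
    exact hij rfl
  · ext i
    simp

theorem finite_partition_sums (f : Finset N → ℝ) (K : Set (Finset N)) (S : Finset N) :
    {x : ℝ | ∃ P, IsPartitionInto K S P ∧ x = ∑ T ∈ P, f T}.Finite := by
  refine (Set.finite_range fun P : Finset (Finset N) => ∑ T ∈ P, f T).subset ?_
  rintro _ ⟨P, -, rfl⟩
  exact ⟨P, rfl⟩

theorem upperC_le_sum (h : IsPartitionInto K S P) : upperC f K S ≤ ∑ T ∈ P, f T := by
  by_cases hS : S = ∅
  · subst hS
    have hP : P = ∅ := Finset.eq_empty_of_forall_notMem fun T hT =>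
      h.2.1 T hT (Finset.subset_empty.mp (h.subset hT))
    simp [upperC, hP]
  · rw [upperC_eq_sInf hS]
    exact csInf_le (finite_partition_sums f K S).bddBelow ⟨P, h, rfl⟩

theorem exists_upperC_eq_sum (f : Finset N → ℝ) (hK : K0 N ⊆ K) (S : Finset N) :
    ∃ P, IsPartitionInto K S P ∧ upperC f K S = ∑ T ∈ P, f T := by
  by_cases hS : S = ∅
  · subst hS
    exact ⟨∅, by simp [IsPartitionInto], by simp [upperC]⟩
  · rw [upperC_eq_sInf hS]
    have hne : {x : ℝ | ∃ P, IsPartitionInto K S P ∧ x = ∑ T ∈ P, f T}.Nonempty :=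
      ⟨_, _, isPartitionInto_singletons hK S, rfl⟩
    exact hne.csInf_mem (finite_partition_sums f K S)

theorem le_upperC (hf0 : f ∅ = 0) (hsub : SubadditiveSF f) (hK : K0 N ⊆ K) (S : Finset N) :
    f S ≤ upperC f K S := by
  obtain ⟨P, hP, h⟩ := exists_upperC_eq_sum f hK S
  exact h ▸ hP.le_sum hf0 hsub

theorem upperC_anti (hK : K0 N ⊆ K) (hKL : K ⊆ L) : upperC f L S ≤ upperC f K S := by
  obtain ⟨P, hP, h⟩ := exists_upperC_eq_sum f hK S
  exact h ▸ upperC_le_sum (hP.of_forall_mem fun T hT => hKL (hP.1 T hT))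

theorem upperC_eq_of_mem (hf0 : f ∅ = 0) (hsub : SubadditiveSF f) (hK : K0 N ⊆ K)
    (hS : S ∈ K) : upperC f K S = f S := by
  refine le_antisymm ?_ (le_upperC hf0 hsub hK S)
  by_cases h : S = ∅
  · simp [upperC, h, hf0]
  · have hP : IsPartitionInto K S {S} := by
      refine ⟨by simpa, by simpa, ?_, by simp⟩
      intro A hA B hB hAB
      rw [Finset.mem_singleton] at hA hB
      exact absurd (hA.trans hB.symm) hAB
    simpa using upperC_le_sum (f := f) hP

theorem finite_lower_values (f : Finset N → ℝ) (K : Set (Finset N)) (S : Finset N) :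
    {x : ℝ | ∃ T ∈ K, S ⊆ T ∧ x = f T - upperC f K (T \ S)}.Finite := by
  refine (Set.finite_range fun T : Finset N => f T - upperC f K (T \ S)).subset ?_
  rintro _ ⟨T, -, -, rfl⟩
  exact ⟨T, rfl⟩

theorem le_lowerC (hT : T ∈ K) (hST : S ⊆ T) : f T - upperC f K (T \ S) ≤ lowerC f K S :=
  le_csSup (finite_lower_values f K S).bddAbove ⟨T, hT, hST, rfl⟩

theorem exists_lowerC_eq (f : Finset N → ℝ) (hK : K0 N ⊆ K) (S : Finset N) :
    ∃ T ∈ K, S ⊆ T ∧ lowerC f K S = f T - upperC f K (T \ S) := by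
  have hne : {x : ℝ | ∃ T ∈ K, S ⊆ T ∧ x = f T - upperC f K (T \ S)}.Nonempty :=
    ⟨_, Finset.univ, hK (Or.inl (Or.inr rfl)), Finset.subset_univ S, rfl⟩
  exact hne.csSup_mem (finite_lower_values f K S)

theorem lowerC_mono (hK : K0 N ⊆ K) (hKL : K ⊆ L) : lowerC f K S ≤ lowerC f L S := by
  obtain ⟨T, hT, hST, h⟩ := exists_lowerC_eq f hK S
  have h₁ := le_lowerC (f := f) (hKL hT) hST
  have h₂ := upperC_anti (f := f) (S := T \ S) hK hKL
  linarith

theorem lowerC_eq_of_mem (hf0 : f ∅ = 0) (hsub : SubadditiveSF f) (hK : K0 N ⊆ K)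
    (hS : S ∈ K) : lowerC f K S = f S := by
  apply le_antisymm
  · obtain ⟨T, -, hST, h⟩ := exists_lowerC_eq f hK S
    have h₁ := le_upperC hf0 hsub hK (T \ S)
    have h₂ := hsub S (T \ S) Finset.disjoint_sdiff
    rw [Finset.union_sdiff_of_subset hST] at h₂
    linarith
  · simpa [upperC] using le_lowerC (f := f) hS (Finset.Subset.refl S)

/-- The gap between the two completions at a single set. -/
noncomputable def completionGap (f : Finset N → ℝ) (K : Set (Finset N)) (T : Finset N) : ℝ :=
  upperC f K T - lowerC f K T

theorem completionGap_anti (hK : K0 N ⊆ K) (hKL : K ⊆ L) :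
    completionGap f L T ≤ completionGap f K T :=
  sub_le_sub (upperC_anti hK hKL) (lowerC_mono hK hKL)

theorem completionGap_eq_zero (hf0 : f ∅ = 0) (hsub : SubadditiveSF f) (hK : K0 N ⊆ K)
    (hT : T ∈ K) : completionGap f K T = 0 := by
  rw [completionGap, upperC_eq_of_mem hf0 hsub hK hT, lowerC_eq_of_mem hf0 hsub hK hT, sub_self]

theorem completionGap_le {W : Finset N} {Q : Finset (Finset N)} (hP : IsPartitionInto K T P)
    (hW : W ∈ K) (hTW : T ⊆ W) (hQ : IsPartitionInto K (W \ T) Q) :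
    completionGap f K T ≤ ∑ A ∈ P, f A - f W + ∑ A ∈ Q, f A := by
  have h₁ := upperC_le_sum (f := f) hP
  have h₂ := upperC_le_sum (f := f) hQ
  have h₃ := le_lowerC (f := f) hW hTW
  rw [completionGap]
  linarith

theorem exists_completionGap_eq (f : Finset N → ℝ) (hK : K0 N ⊆ K) (T : Finset N) :
    ∃ W ∈ K, T ⊆ W ∧ ∃ P Q, IsPartitionInto K T P ∧ IsPartitionInto K (W \ T) Q ∧
      completionGap f K T = ∑ A ∈ P, f A - f W + ∑ A ∈ Q, f A := by
  obtain ⟨W, hW, hTW, hl⟩ := exists_lowerC_eq f hK T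
  obtain ⟨P, hP, hp⟩ := exists_upperC_eq_sum f hK T
  obtain ⟨Q, hQ, hq⟩ := exists_upperC_eq_sum f hK (W \ T)
  refine ⟨W, hW, hTW, P, Q, hP, hQ, ?_⟩
  rw [completionGap, hl, hp, hq]
  ring

/-- On at most four points, the families realising a completion gap at `T` never use two
distinct nontrivial sets other than `T`. -/
theorem eq_of_mem_completion_families (hcard : Fintype.card N ≤ 4) {W Z : Finset N}
    {Q : Finset (Finset N)} (hS : S ∉ K0 N) (hZ : Z ∉ K0 N) (hT : T ∉ K0 N) (hST : S ≠ T)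
    (hZT : Z ≠ T) (hTW : T ⊆ W) (hP : IsPartitionInto K T P) (hQ : IsPartitionInto K (W \ T) Q)
    (hS' : S = W ∨ S ∈ P ∨ S ∈ Q) (hZ' : Z = W ∨ Z ∈ P ∨ Z ∈ Q) : S = Z := by
  have hWT := Finset.card_sdiff_add_card_eq_card hTW
  have hWN := Finset.card_le_univ W
  have hTN := card_lt_of_notMem_K0 hT
  have hT2 := two_le_card_of_notMem_K0 hT
  have inner {A : Finset N} (hA : A ∈ P) (hAT : A ≠ T) : A.card < T.card :=
    Finset.card_lt_card ((hP.subset hA).ssubset_of_ne hAT)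
  have outer {A : Finset N} (hA : A ∈ Q) : A.card ≤ (W \ T).card :=
    Finset.card_le_card (hQ.subset hA)
  have proper {A : Finset N} (hA : A = W) (hAT : A ≠ T) : T.card < W.card :=
    Finset.card_lt_card (hTW.ssubset_of_ne fun h => hAT (hA.trans h.symm))
  have packed {B : Finset N} {R : Finset (Finset N)} (hR : IsPartitionInto K B R)
      (hSR : S ∈ R) (hZR : Z ∈ R) (h : S ≠ Z) : S.card + Z.card ≤ B.card := by
    rw [← Finset.card_union_of_disjoint (hR.2.2.1 S hSR Z hZR h)]
    exact Finset.card_le_card (Finset.union_subset (hR.subset hSR) (hR.subset hZR))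
  have hS2 := two_le_card_of_notMem_K0 hS
  have hZ2 := two_le_card_of_notMem_K0 hZ
  have hSN := card_lt_of_notMem_K0 hS
  have hZN := card_lt_of_notMem_K0 hZ
  by_contra hne
  rcases hS' with hSW | hSP | hSQ <;> rcases hZ' with hZW | hZP | hZQ
  · exact hne (hSW.trans hZW.symm)
  · have := inner hZP hZT
    have := proper hSW hST
    subst hSW
    omega
  · have := outer hZQ
    subst hSW
    omega
  · have := inner hSP hST
    have := proper hZW hZT
    subst hZW
    omega
  · have := packed hP hSP hZP hne
    omega
  · have := inner hSP hST
    have := outer hZQ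
    omega
  · have := outer hSQ
    subst hZW
    omega
  · have := inner hZP hZT
    have := outer hSQ
    omega
  · have := packed hQ hSQ hZQ hne
    omega

/-- Away from the revealed sets, revealing two sets gives no more than the better of the two. -/
theorem min_completionGap_le (hcard : Fintype.card N ≤ 4) {Z : Finset N} (hK : K0 N ⊆ K)
    (hS : S ∉ K0 N) (hZ : Z ∉ K0 N) (hT : T ∉ K0 N) (hST : S ≠ T) (hZT : Z ≠ T) (hSZ : S ≠ Z) :
    min (completionGap f (K ∪ {S}) T) (completionGap f (K ∪ {Z}) T) ≤
      completionGap f (K ∪ {S, Z}) T := by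
  obtain ⟨W, hW, hTW, P, Q, hP, hQ, h⟩ :=
    exists_completionGap_eq f (hK.trans (Set.subset_union_left (t := {S, Z}))) T
  rw [h]
  have drop_right {A : Finset N} (hA : A ∈ K ∪ {S, Z}) (hAZ : A ≠ Z) : A ∈ K ∪ {S} := by
    simp only [Set.mem_union, Set.mem_insert_iff, Set.mem_singleton_iff] at hA ⊢
    tauto
  have drop_left {A : Finset N} (hA : A ∈ K ∪ {S, Z}) (hAS : A ≠ S) : A ∈ K ∪ {Z} := by
    simp only [Set.mem_union, Set.mem_insert_iff, Set.mem_singleton_iff] at hA ⊢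
    tauto
  by_cases hZ' : Z = W ∨ Z ∈ P ∨ Z ∈ Q
  · have hS' : ¬(S = W ∨ S ∈ P ∨ S ∈ Q) := fun hS' => hSZ
      (eq_of_mem_completion_families hcard hS hZ hT hST hZT hTW hP hQ hS' hZ')
    push Not at hS'
    exact min_le_of_right_le (completionGap_le
      (hP.of_forall_mem fun A hA => drop_left (hP.1 A hA) (ne_of_mem_of_not_mem hA hS'.2.1))
      (drop_left hW hS'.1.symm) hTW
      (hQ.of_forall_mem fun A hA => drop_left (hQ.1 A hA) (ne_of_mem_of_not_mem hA hS'.2.2)))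
  · push Not at hZ'
    exact min_le_of_left_le (completionGap_le
      (hP.of_forall_mem fun A hA => drop_right (hP.1 A hA) (ne_of_mem_of_not_mem hA hZ'.2.1))
      (drop_right hW hZ'.1.symm) hTW
      (hQ.of_forall_mem fun A hA => drop_right (hQ.1 A hA) (ne_of_mem_of_not_mem hA hZ'.2.2)))

theorem completionGap_supermodular (hcard : Fintype.card N ≤ 4) (hf0 : f ∅ = 0)
    (hsub : SubadditiveSF f) {Z : Finset N} (hK : K0 N ⊆ K) (hS : S ∉ K0 N) (hZ : Z ∉ K0 N)
    (hSZ : S ≠ Z) (T : Finset N) :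
    completionGap f (K ∪ {Z}) T - completionGap f K T ≤
      completionGap f (K ∪ {S, Z}) T - completionGap f (K ∪ {S}) T := by
  have hKS : K0 N ⊆ K ∪ {S} := hK.trans Set.subset_union_left
  have hKZ : K0 N ⊆ K ∪ {Z} := hK.trans Set.subset_union_left
  have hKSZ : K0 N ⊆ K ∪ {S, Z} := hK.trans Set.subset_union_left
  have hS_anti : completionGap f (K ∪ {S}) T ≤ completionGap f K T :=
    completionGap_anti hK Set.subset_union_left
  have hZ_anti : completionGap f (K ∪ {Z}) T ≤ completionGap f K T :=
    completionGap_anti hK Set.subset_union_left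
  by_cases hTS : T = S
  · rw [completionGap_eq_zero hf0 hsub hKS (by simp [hTS]),
      completionGap_eq_zero hf0 hsub hKSZ (by simp [hTS])]
    linarith
  by_cases hTZ : T = Z
  · rw [completionGap_eq_zero hf0 hsub hKZ (by simp [hTZ]),
      completionGap_eq_zero hf0 hsub hKSZ (by simp [hTZ])]
    linarith
  by_cases hT : T ∈ K0 N
  · rw [completionGap_eq_zero hf0 hsub hKS (hKS hT), completionGap_eq_zero hf0 hsub hKZ (hKZ hT),
      completionGap_eq_zero hf0 hsub hKSZ (hKSZ hT), completionGap_eq_zero hf0 hsub hK (hK hT)]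
  · have h := min_completionGap_le (f := f) hcard hK hS hZ hT (Ne.symm hTS) (Ne.symm hTZ) hSZ
    rcases min_le_iff.mp h with h | h <;> linarith

end Completions

/-- for `|N| ≤ 4` and subadditive `f`, the ℓ¹-divergence is supermodular
on subsets of `2^N \ K0`. -/
theorem divergence_supermodular_small {N : Type*} [Fintype N] [DecidableEq N]
    (hcard : Fintype.card N ≤ 4)
    (f : Finset N → ℝ) (hf0 : f ∅ = 0) (hsub : SubadditiveSF f) :
    ∀ K : Set (Finset N), K ⊆ (K0 N)ᶜ →
      ∀ S Z : Finset N, S ∉ K0 N → Z ∉ K0 N → S ∉ K → Z ∉ K → S ≠ Z →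
        ldiv f (K ∪ {Z}) - ldiv f K ≤
          ldiv f (K ∪ {S, Z}) - ldiv f (K ∪ {S}) := by
  intro K _ S Z hS hZ _ _ hSZ
  simp only [ldiv, ← Set.union_assoc, ← Finset.sum_sub_distrib]
  exact Finset.sum_le_sum fun T _ =>
    completionGap_supermodular hcard hf0 hsub Set.subset_union_left hS hZ hSZ T
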